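/- arXiv:1608.01827 — 4 statements merged into one kernel-verified Lean document; each statement's English description precedes it below -/
import Mathlib

section
/- If Q_{k+2} ≥ 0 (the VO at position k+2 is of type 1), then W̃_k(b) ≥ W_k(b) for every b ∈ {0,1}^k: moving the type-1 VO from position k+2 to position k+1 does not decrease the step-k value function. -/
open Finset

/-- Total offloading benefit `Σ_{t<T} f_t(Σ_{n<N} b_n X_n^t)` (0-based indices). -/
noncomputable def socialOffload (T N : ℕ) (f : ℕ → ℝ → ℝ) (X : ℕ → ℕ → ℝ)
    (b : ℕ → Bool) : ℝ :=
  ∑ t ∈ range T, f t (∑ n ∈ range N, if b n then X n t else 0)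

/-- `Waux T N f X Q j b = W_{N-j}(b)`: backward recursion on the number `j` of
remaining bargaining steps.  At step `k = N - (j+1)` (0-based) the recursion is
`W_k(b) = ½·W_{k+1}(b,0) + ½·max{W_{k+1}(b,0), W_{k+1}(b,1) + Q_k}`. -/
noncomputable def Waux (T N : ℕ) (f : ℕ → ℝ → ℝ) (X : ℕ → ℕ → ℝ) (Q : ℕ → ℝ) :
    ℕ → (ℕ → Bool) → ℝ
  | 0, b => socialOffload T N f X b
  | j + 1, b =>
      (1 / 2) * Waux T N f X Q j (Function.update b (N - (j + 1)) false)
        + (1 / 2) *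
          max (Waux T N f X Q j (Function.update b (N - (j + 1)) false))
            (Waux T N f X Q j (Function.update b (N - (j + 1)) true) + Q (N - (j + 1)))

/-- The value function `W_k(b)` of the sequential one-to-many Nash bargaining
(0-based: VO `n` has parameters `Q n`, `X n ·`; `b` is the prefix of outcomes,
only its entries `0,…,k-1` matter). -/
noncomputable def W (T N : ℕ) (f : ℕ → ℝ → ℝ) (X : ℕ → ℕ → ℝ) (Q : ℕ → ℝ)
    (k : ℕ) (b : ℕ → Bool) : ℝ :=
  Waux T N f X Q (N - k) b

/-- Parameters obtained by interchanging the VOs at (0-based) positions `k` and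
`k+1` (paper positions `k+1` and `k+2`). -/
def swapQ (Q : ℕ → ℝ) (k : ℕ) : ℕ → ℝ :=
  fun n => if n = k then Q (k + 1) else if n = k + 1 then Q k else Q n

def swapX (X : ℕ → ℕ → ℝ) (k : ℕ) : ℕ → ℕ → ℝ :=
  fun n t => if n = k then X (k + 1) t else if n = k + 1 then X k t else X n t

/-- The total offloading benefit is monotone in the vector of outcomes. -/
theorem socialOffload_mono {T N : ℕ} {f : ℕ → ℝ → ℝ} {X : ℕ → ℕ → ℝ}
    (hf : ∀ t, t < T → MonotoneOn (f t) (Set.Ici (0 : ℝ)))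
    (hX : ∀ n, n < N → ∀ t, t < T → 0 ≤ X n t) :
    Monotone (socialOffload T N f X) := by
  intro b b' h
  refine sum_le_sum fun t ht => ?_
  have ht := mem_range.1 ht
  have hnonneg (c : ℕ → Bool) : 0 ≤ ∑ n ∈ range N, if c n then X n t else 0 :=
    sum_nonneg fun n hn => ite_nonneg (hX n (mem_range.1 hn) t ht) le_rfl
  refine hf t ht (hnonneg b) (hnonneg b') (sum_le_sum fun n hn => ?_)
  have hn := hX n (mem_range.1 hn) t ht
  have hb := h n
  cases h1 : b n <;> cases h2 : b' n <;> simp_all [Bool.le_iff_imp]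

/-- The value functions are monotone in the vector of outcomes. -/
theorem Waux_mono {T N : ℕ} {f : ℕ → ℝ → ℝ} {X : ℕ → ℕ → ℝ} (Q : ℕ → ℝ)
    (hf : ∀ t, t < T → MonotoneOn (f t) (Set.Ici (0 : ℝ)))
    (hX : ∀ n, n < N → ∀ t, t < T → 0 ≤ X n t) (j : ℕ) :
    Monotone (Waux T N f X Q j) := by
  induction j with
  | zero => exact socialOffload_mono hf hX
  | succ j ih =>
    intro b b' h
    have hu (v : Bool) : Waux T N f X Q j (Function.update b (N - (j + 1)) v) ≤
        Waux T N f X Q j (Function.update b' (N - (j + 1)) v) :=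
      ih (update_le_update_iff.2 ⟨le_rfl, fun n _ => h n⟩)
    have h0 := hu false
    have h1 := hu true
    simp only [Waux]
    gcongr

/-- Interchanging the parameters at `k` and `k + 1` amounts to interchanging the outcomes. -/
theorem socialOffload_swapX {T N : ℕ} {f : ℕ → ℝ → ℝ} {X : ℕ → ℕ → ℝ} {k : ℕ}
    (hk : k + 2 ≤ N) (b : ℕ → Bool) :
    socialOffload T N f (swapX X k) b =
      socialOffload T N f X (b ∘ Equiv.swap k (k + 1)) := by
  refine sum_congr rfl fun t _ => congrArg (f t) ?_
  refine sum_equiv (Equiv.swap k (k + 1)) (fun n => ?_) fun n _ => ?_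
  · simp only [mem_range, Equiv.swap_apply_def]
    split_ifs <;> omega
  · rw [Function.comp_apply, Equiv.swap_apply_self]
    congr 1
    simp only [swapX, Equiv.swap_apply_def]
    split_ifs <;> rfl

/-- After positions `k` and `k + 1` have been settled, interchanging their parameters amounts to
interchanging their outcomes. -/
theorem Waux_swap {T N : ℕ} {f : ℕ → ℝ → ℝ} {X : ℕ → ℕ → ℝ} {Q : ℕ → ℝ} {k : ℕ}
    (j : ℕ) (hj : k + 2 + j ≤ N) (b : ℕ → Bool) :
    Waux T N f (swapX X k) (swapQ Q k) j b =
      Waux T N f X Q j (b ∘ Equiv.swap k (k + 1)) := by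
  induction j generalizing b with
  | zero => exact socialOffload_swapX hj b
  | succ j ih =>
    have hu (v : Bool) : Function.update b (N - (j + 1)) v ∘ Equiv.swap k (k + 1) =
        Function.update (b ∘ Equiv.swap k (k + 1)) (N - (j + 1)) v := by
      have hs : Equiv.swap k (k + 1) (N - (j + 1)) = N - (j + 1) :=
        Equiv.swap_apply_of_ne_of_ne (by omega) (by omega)
      conv_lhs => rw [← hs]
      rw [Function.update_comp_eq_of_injective _ (Equiv.injective _)]
    have hQ : swapQ Q k (N - (j + 1)) = Q (N - (j + 1)) := by
      rw [swapQ, if_neg (by omega), if_neg (by omega)]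
    simp only [Waux, ih (by omega), hu, hQ]

/-- Lemma 5: if the VO at (paper) position `k+2` is of type 1
(`Q_{k+2} ≥ 0`), moving it one position earlier does not decrease the step-`k`
value function. -/
theorem swap_type1_W_le (T N : ℕ) (hT : 1 ≤ T) (hN : 2 ≤ N)
    (f : ℕ → ℝ → ℝ) (X : ℕ → ℕ → ℝ) (Q : ℕ → ℝ)
    (hf : ∀ t, t < T → MonotoneOn (f t) (Set.Ici (0 : ℝ)) ∧
      ConcaveOn ℝ (Set.Ici (0 : ℝ)) (f t) ∧ f t 0 = 0)
    (hX : ∀ n, n < N → ∀ t, t < T → 0 ≤ X n t)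
    (k : ℕ) (hk : k + 2 ≤ N) (hQ : 0 ≤ Q (k + 1)) :
    ∀ b : ℕ → Bool,
      W T N f X Q k b ≤ W T N f (swapX X k) (swapQ Q k) k b := by
  intro b
  obtain ⟨j, rfl⟩ : ∃ j, N = k + 2 + j := ⟨N - (k + 2), by omega⟩
  have hmono := Waux_mono Q (fun t ht => (hf t ht).1) hX j
  have hswap (u v : Bool) :
      Function.update (Function.update b k u) (k + 1) v ∘ Equiv.swap k (k + 1) =
        Function.update (Function.update b k v) (k + 1) u := by
    funext n
    simp only [Function.comp_apply, Function.update_apply, Equiv.swap_apply_def]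
    split_ifs <;> first | rfl | omega
  have hle (u : Bool) :
      Waux T (k + 2 + j) f X Q j (Function.update (Function.update b k u) (k + 1) false) ≤
        Waux T (k + 2 + j) f X Q j (Function.update (Function.update b k u) (k + 1) true) :=
    hmono (update_le_update_iff.2 ⟨Bool.false_le _, fun _ _ => le_rfl⟩)
  have h0 := hle false
  have h1 := hle true
  have e : k + 2 + j - k = j + 1 + 1 := by omega
  have e1 : k + 2 + j - (j + 1 + 1) = k := by omega
  have e2 : k + 2 + j - (j + 1) = k + 1 := by omega
  have hQk : swapQ Q k k = Q (k + 1) := by simp [swapQ]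
  have hQk1 : swapQ Q k (k + 1) = Q k := by simp [swapQ]
  simp only [W, e, Waux, e1, e2, Waux_swap j le_rfl, hswap, hQk, hQk1]
  generalize Waux T _ f X Q j _ = w00 at *
  generalize Waux T _ f X Q j _ = w01 at *
  generalize Waux T _ f X Q j _ = w10 at *
  generalize Waux T _ f X Q j _ = w11 at *
  grind
end

section
/- If Σ_{t=1}^T f_t(X_k^t) + Q_k < 0 for some k ∈ {1,…,N} (VO k is of type 3), then Δ_k(b) < 0 for every b ∈ {0,1}^{k−1}; consequently the MNO never cooperates with VO k regardless of the outcomes of all prior bargaining steps, and in particular b̂_k = 0 and π̂_k = 0. -/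
open Finset

/-- `Δ_k(b) = W_{k+1}(b,1) − W_{k+1}(b,0) + Q_k` (0-based step `k`, prefix `b` of
length `k`; paper's `Δ_{k+1}`). -/
noncomputable def Delta (T N : ℕ) (f : ℕ → ℝ → ℝ) (X : ℕ → ℕ → ℝ) (Q : ℕ → ℝ)
    (k : ℕ) (b : ℕ → Bool) : ℝ :=
  W T N f X Q (k + 1) (Function.update b k true)
    - W T N f X Q (k + 1) (Function.update b k false) + Q k

/-- `bhatFn … k` is the realized outcome prefix after the first `k` bargaining
steps: `b̂_k = 1` iff `Δ_k(b̂_1,…,b̂_{k-1}) ≥ 0`. -/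
noncomputable def bhatFn (T N : ℕ) (f : ℕ → ℝ → ℝ) (X : ℕ → ℕ → ℝ) (Q : ℕ → ℝ) :
    ℕ → (ℕ → Bool)
  | 0 => fun _ => false
  | k + 1 =>
      Function.update (bhatFn T N f X Q k) k
        (if 0 ≤ Delta T N f X Q k (bhatFn T N f X Q k) then true else false)

/-- The realized payoff `π̂_k` of the VO bargaining at (0-based) step `k`. -/
noncomputable def pihat (T N : ℕ) (f : ℕ → ℝ → ℝ) (X : ℕ → ℕ → ℝ) (Q : ℕ → ℝ)
    (k : ℕ) : ℝ :=
  if 0 ≤ Delta T N f X Q k (bhatFn T N f X Q k)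
  then Delta T N f X Q k (bhatFn T N f X Q k) / 2 else 0

theorem ConcaveOn.map_add_le_add_of_map_zero_nonneg {g : ℝ → ℝ}
    (hg : ConcaveOn ℝ (Set.Ici (0 : ℝ)) g) (h0 : 0 ≤ g 0) {x y : ℝ} (hx : 0 ≤ x) (hy : 0 ≤ y) :
    g (x + y) ≤ g x + g y := by
  rcases (add_nonneg hx hy).eq_or_lt with h | h
  · obtain rfl : x = 0 := by linarith
    obtain rfl : y = 0 := by linarith
    simpa using h0
  have scale : ∀ z, 0 ≤ z → z ≤ x + y → z / (x + y) * g (x + y) ≤ g z := by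
    intro z hz hzs
    have hc : 0 ≤ 1 - z / (x + y) := sub_nonneg.2 ((div_le_one h).2 hzs)
    have key := hg.2 (Set.mem_Ici.2 h.le) (Set.mem_Ici.2 le_rfl) (div_nonneg hz h.le) hc
      (add_sub_cancel _ _)
    simp only [smul_eq_mul, mul_zero, add_zero, div_mul_cancel₀ z h.ne'] at key
    linarith [mul_nonneg hc h0]
  have hsum : x / (x + y) * g (x + y) + y / (x + y) * g (x + y) = g (x + y) := by
    field_simp
  linarith [scale x hx (by linarith), scale y hy (by linarith)]

theorem socialOffload_update_true_le {T N : ℕ} {f : ℕ → ℝ → ℝ} {X : ℕ → ℕ → ℝ}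
    (hf : ∀ t, t < T → ConcaveOn ℝ (Set.Ici (0 : ℝ)) (f t) ∧ f t 0 = 0)
    (hX : ∀ n, n < N → ∀ t, t < T → 0 ≤ X n t) {k : ℕ} (hk : k < N) (b : ℕ → Bool) :
    socialOffload T N f X (Function.update b k true) ≤
      socialOffload T N f X (Function.update b k false) + ∑ t ∈ range T, f t (X k t) := by
  unfold socialOffload
  rw [← sum_add_distrib]
  refine sum_le_sum fun t ht => ?_
  have ht := mem_range.1 ht
  have hsplit : (∑ n ∈ range N, if Function.update b k true n then X n t else 0) =
      (∑ n ∈ range N, if Function.update b k false n then X n t else 0) + X k t := by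
    rw [← add_sum_erase _ _ (mem_range.2 hk), ← add_sum_erase (range N)
      (fun n => if Function.update b k false n then X n t else 0) (mem_range.2 hk)]
    have hrest : ∀ v, (∑ n ∈ (range N).erase k, if Function.update b k v n then X n t else 0) =
        ∑ n ∈ (range N).erase k, if b n then X n t else 0 := fun v =>
      sum_congr rfl fun n hn => by rw [Function.update_of_ne (ne_of_mem_erase hn)]
    simp [hrest, add_comm]
  rw [hsplit]
  refine (hf t ht).1.map_add_le_add_of_map_zero_nonneg (hf t ht).2.ge
    (sum_nonneg fun n hn => ?_) (hX k hk t ht)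
  split_ifs
  exacts [hX n (mem_range.1 hn) t ht, le_rfl]

theorem Waux_update_true_le {T N : ℕ} {f : ℕ → ℝ → ℝ} {X : ℕ → ℕ → ℝ} (Q : ℕ → ℝ)
    (hf : ∀ t, t < T → ConcaveOn ℝ (Set.Ici (0 : ℝ)) (f t) ∧ f t 0 = 0)
    (hX : ∀ n, n < N → ∀ t, t < T → 0 ≤ X n t) {k : ℕ} {j : ℕ} (hj : k + j < N)
    (b : ℕ → Bool) :
    Waux T N f X Q j (Function.update b k true) ≤
      Waux T N f X Q j (Function.update b k false) + ∑ t ∈ range T, f t (X k t) := by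
  induction j generalizing b with
  | zero => exact socialOffload_update_true_le hf hX hj b
  | succ j ih =>
    have hne : k ≠ N - (j + 1) := by omega
    have h0 := ih (by omega) (Function.update b (N - (j + 1)) false)
    have h1 := ih (by omega) (Function.update b (N - (j + 1)) true)
    simp only [Waux, Function.update_comm hne]
    have hmax := max_le_max h0 (add_le_add_left h1 (Q (N - (j + 1))))
    rw [add_right_comm, max_add_add_right] at hmax
    linarith

theorem bhatFn_eq_of_lt (T N : ℕ) (f : ℕ → ℝ → ℝ) (X : ℕ → ℕ → ℝ) (Q : ℕ → ℝ) {k m : ℕ}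
    (h : k < m) : bhatFn T N f X Q m k = bhatFn T N f X Q (k + 1) k := by
  induction m, h using Nat.le_induction with
  | base => rfl
  | succ m hm ih => rw [bhatFn, Function.update_of_ne (by omega), ih]

/-- Proposition 3 of the paper, type-3 VOs: if VO `k` is of type 3
(`Σ_t f_t(X_k^t) + Q_k < 0`), then `Δ_k(b) < 0` for every prior-outcome prefix
`b`; consequently the MNO never cooperates with VO `k`, and in particular
`b̂_k = 0` and `π̂_k = 0`. -/
theorem type3_never_cooperate (T N : ℕ) (hT : 1 ≤ T) (hN : 1 ≤ N)
    (f : ℕ → ℝ → ℝ) (X : ℕ → ℕ → ℝ) (Q : ℕ → ℝ)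
    (hf : ∀ t, t < T → MonotoneOn (f t) (Set.Ici (0 : ℝ)) ∧
      ConcaveOn ℝ (Set.Ici (0 : ℝ)) (f t) ∧ f t 0 = 0)
    (hX : ∀ n, n < N → ∀ t, t < T → 0 ≤ X n t)
    (k : ℕ) (hk : k < N)
    (hQ : (∑ t ∈ range T, f t (X k t)) + Q k < 0) :
    (∀ b : ℕ → Bool, Delta T N f X Q k b < 0) ∧
      bhatFn T N f X Q N k = false ∧ pihat T N f X Q k = 0 := by
  have hΔ : ∀ b : ℕ → Bool, Delta T N f X Q k b < 0 := fun b => by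
    have h := Waux_update_true_le Q (fun t ht => (hf t ht).2) hX
      (show k + (N - (k + 1)) < N by omega) b
    unfold Delta W
    linarith
  refine ⟨hΔ, ?_, if_neg (hΔ _).not_ge⟩
  rw [bhatFn_eq_of_lt T N f X Q hk, bhatFn, Function.update_self, if_neg (hΔ _).not_ge]
end

section
/- Let σ be a permutation of {1,…,N} such that the VOs σ(1),…,σ(N_1) are exactly the type-1 VOs and the VOs σ(N_1+N_2+1),…,σ(N) are exactly the type-3 VOs. If τ is obtained from σ by interchanging the positions of two type-1 VOs, or by interchanging the positions of two type-3 VOs, then U_0^τ = U_0^σ: the MNO's payoff does not change. -/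
open Finset

/-- Parameters reindexed by a bargaining sequence `σ`: at (0-based) step `k < N`
the MNO bargains with VO `σ k`. -/
noncomputable def permQ (N : ℕ) (Q : ℕ → ℝ) (σ : Equiv.Perm (Fin N)) : ℕ → ℝ :=
  fun k => if h : k < N then Q ((σ ⟨k, h⟩ : Fin N) : ℕ) else Q k

noncomputable def permX (N : ℕ) (X : ℕ → ℕ → ℝ) (σ : Equiv.Perm (Fin N)) :
    ℕ → ℕ → ℝ :=
  fun n t => if h : n < N then X ((σ ⟨n, h⟩ : Fin N) : ℕ) t else X n t

/-- `U_0^σ = W_0^σ`: the MNO's payoff under the bargaining sequence `σ`. -/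
noncomputable def U0perm (T N : ℕ) (f : ℕ → ℝ → ℝ) (X : ℕ → ℕ → ℝ) (Q : ℕ → ℝ)
    (σ : Equiv.Perm (Fin N)) : ℝ :=
  W T N f (permX N X σ) (permQ N Q σ) 0 (fun _ => false)

/-- `N₁`: the number of type-1 VOs (those with `Q_n ≥ 0`). -/
noncomputable def numType1 (N : ℕ) (Q : ℕ → ℝ) : ℕ :=
  ((range N).filter fun n => 0 ≤ Q n).card

/-- `N₂`: the number of type-2 VOs (`Q_n < 0` and `Σ_t f_t(X_n^t) + Q_n ≥ 0`). -/
noncomputable def numType2 (T N : ℕ) (f : ℕ → ℝ → ℝ) (X : ℕ → ℕ → ℝ)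
    (Q : ℕ → ℝ) : ℕ :=
  ((range N).filter fun n =>
    Q n < 0 ∧ 0 ≤ (∑ t ∈ range T, f t (X n t)) + Q n).card

/-- `N₃`: the number of type-3 VOs (`Σ_t f_t(X_n^t) + Q_n < 0`). -/
noncomputable def numType3 (T N : ℕ) (f : ℕ → ℝ → ℝ) (X : ℕ → ℕ → ℝ)
    (Q : ℕ → ℝ) : ℕ :=
  ((range N).filter fun n => (∑ t ∈ range T, f t (X n t)) + Q n < 0).card

/-- Value of bargaining with the agents of a list in turn, where accepting agent `a` adds `x a`
to the current state and contributes `q a`, and `F` is the terminal benefit. -/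
noncomputable def bargainValue {E ι : Type*} [Add E] (F : E → ℝ) (x : ι → E) (q : ι → ℝ) :
    List ι → E → ℝ
  | [], y => F y
  | a :: l, y =>
      (1 / 2) * bargainValue F x q l y
        + (1 / 2) * max (bargainValue F x q l y) (bargainValue F x q l (y + x a) + q a)

section bargainValue

variable {E ι : Type*} [AddCommMonoid E] [PartialOrder E] [IsOrderedAddMonoid E]
  {F : E → ℝ} {x : ι → E} {q : ι → ℝ}

lemma bargainValue_monotoneOn (hF : MonotoneOn F (Set.Ici 0)) (hx : ∀ a, 0 ≤ x a) (l : List ι) :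
    MonotoneOn (bargainValue F x q l) (Set.Ici 0) := by
  induction l with
  | nil => exact hF
  | cons a l ih =>
    intro y hy z hz hyz
    have h₁ := ih hy hz hyz
    have h₂ := ih (Set.mem_Ici.2 (add_nonneg hy (hx a))) (Set.mem_Ici.2 (add_nonneg hz (hx a)))
      (add_le_add_left hyz (x a))
    simp only [bargainValue]
    gcongr

lemma bargainValue_cons_of_nonneg (hF : MonotoneOn F (Set.Ici 0)) (hx : ∀ a, 0 ≤ x a) {a : ι}
    (ha : 0 ≤ q a) (l : List ι) {y : E} (hy : 0 ≤ y) :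
    bargainValue F x q (a :: l) y =
      (1 / 2) * bargainValue F x q l y + (1 / 2) * (bargainValue F x q l (y + x a) + q a) := by
  have h := bargainValue_monotoneOn (q := q) hF hx l hy (Set.mem_Ici.2 (add_nonneg hy (hx a)))
    (le_add_of_nonneg_right (hx a))
  rw [bargainValue, max_eq_right (by linarith)]

lemma bargainValue_append_congr_left (hF : MonotoneOn F (Set.Ici 0)) (hx : ∀ a, 0 ≤ x a)
    {l l' : List ι} (h : l.Perm l') (m : List ι) (hl : ∀ a ∈ l, 0 ≤ q a) {y : E} (hy : 0 ≤ y) :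
    bargainValue F x q (l ++ m) y = bargainValue F x q (l' ++ m) y := by
  induction h generalizing y with
  | nil => rfl
  | cons a _ ih =>
    have hl' := fun b hb => hl b (List.mem_cons_of_mem _ hb)
    simp only [List.cons_append, bargainValue]
    rw [ih hl' hy, ih hl' (add_nonneg hy (hx a))]
  | swap a b l =>
    have ha : 0 ≤ q a := hl a (by simp)
    have hb : 0 ≤ q b := hl b (by simp)
    have hya := add_nonneg hy (hx a)
    have hyb := add_nonneg hy (hx b)
    simp only [List.cons_append]
    rw [bargainValue_cons_of_nonneg hF hx hb _ hy, bargainValue_cons_of_nonneg hF hx ha _ hy,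
      bargainValue_cons_of_nonneg hF hx ha _ hy, bargainValue_cons_of_nonneg hF hx hb _ hy,
      bargainValue_cons_of_nonneg hF hx ha _ hyb, bargainValue_cons_of_nonneg hF hx hb _ hya,
      add_right_comm y (x b)]
    ring
  | trans h₁ _ ih₁ ih₂ =>
    rw [ih₁ hl hy, ih₂ (fun a ha => hl a (h₁.mem_iff.2 ha)) hy]

lemma bargainValue_eq_of_refused {l : List ι}
    (hl : ∀ a ∈ l, ∀ y, 0 ≤ y → F (y + x a) + q a ≤ F y) (hx : ∀ a, 0 ≤ x a) {y : E}
    (hy : 0 ≤ y) : bargainValue F x q l y = F y := by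
  induction l generalizing y with
  | nil => rfl
  | cons a l ih =>
    have hl' := fun b hb => hl b (List.mem_cons_of_mem _ hb)
    rw [bargainValue, ih hl' hy, ih hl' (add_nonneg hy (hx a)),
      max_eq_left (hl a (by simp) y hy)]
    ring

lemma bargainValue_append_of_refused (l : List ι) {m : List ι}
    (hm : ∀ a ∈ m, ∀ y, 0 ≤ y → F (y + x a) + q a ≤ F y) (hx : ∀ a, 0 ≤ x a) {y : E}
    (hy : 0 ≤ y) : bargainValue F x q (l ++ m) y = bargainValue F x q l y := by
  induction l generalizing y with
  | nil => exact bargainValue_eq_of_refused hm hx hy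
  | cons a l ih =>
    simp only [List.cons_append, bargainValue]
    rw [ih hy, ih (add_nonneg hy (hx a))]

end bargainValue

lemma ConcaveOn.map_add_le_of_map_zero {f : ℝ → ℝ} (hf : ConcaveOn ℝ (Set.Ici 0) f)
    (h0 : f 0 = 0) {x y : ℝ} (hx : 0 ≤ x) (hy : 0 ≤ y) : f (x + y) ≤ f x + f y := by
  rcases (add_nonneg hx hy).eq_or_lt with hs | hs
  · obtain rfl : x = 0 := by linarith
    obtain rfl : y = 0 := by linarith
    simp [h0]
  · have key : ∀ z, 0 ≤ z → z ≤ x + y → z / (x + y) * f (x + y) ≤ f z := by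
      intro z hz hzs
      have h := hf.2 (Set.mem_Ici.2 hs.le) (Set.mem_Ici.2 le_rfl) (div_nonneg hz hs.le)
        (sub_nonneg.2 ((div_le_one hs).2 hzs)) (by ring)
      simpa [h0, div_mul_cancel₀ z hs.ne'] using h
    have h₁ := key x hx (by linarith)
    have h₂ := key y hy (by linarith)
    calc f (x + y) = x / (x + y) * f (x + y) + y / (x + y) * f (x + y) := by
          field_simp
      _ ≤ _ := add_le_add h₁ h₂

lemma Waux_eq_bargainValue (T N : ℕ) (f : ℕ → ℝ → ℝ) (X : ℕ → ℕ → ℝ) (Q : ℕ → ℝ)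
    (σ : Equiv.Perm (Fin N)) (j : ℕ) (hj : j ≤ N) (b : ℕ → Bool) :
    Waux T N f (permX N X σ) (permQ N Q σ) j b =
      bargainValue (fun y : Fin T → ℝ => ∑ t : Fin T, f t (y t))
        (fun (n : Fin N) (t : Fin T) => X n t)
        (fun n => Q n) ((List.ofFn σ).drop (N - j))
        (fun t => ∑ n ∈ range (N - j), if b n then permX N X σ n t else 0) := by
  induction j generalizing b with
  | zero => simp [Waux, socialOffload, bargainValue, Finset.sum_range, List.drop_of_length_le]
  | succ j ih =>
    obtain ⟨k, hk⟩ : ∃ k, k = N - (j + 1) := ⟨_, rfl⟩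
    have hkN : k < N := by omega
    have hk' : N - j = k + 1 := by omega
    have hsum : ∀ v : Bool, (fun t : Fin T => ∑ n ∈ range (k + 1),
        if Function.update b k v n then permX N X σ n t else 0) =
        (fun t : Fin T => ∑ n ∈ range k, if b n then permX N X σ n t else 0) +
          (if v then fun t : Fin T => X (σ ⟨k, hkN⟩) t else 0) := by
      intro v
      funext t
      have : ∀ n ∈ range k, (if Function.update b k v n then permX N X σ n t else 0) =
          if b n then permX N X σ n t else 0 := by
        intro n hn
        rw [Function.update_of_ne (Finset.mem_range.1 hn).ne]
      rw [Finset.sum_range_succ, Finset.sum_congr rfl this]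
      cases v <;> simp [permX, hkN]
    have hdrop : (List.ofFn σ).drop k = σ ⟨k, hkN⟩ :: (List.ofFn σ).drop (k + 1) := by
      rw [List.drop_eq_getElem_cons (by simpa using hkN)]
      simp
    rw [Waux, ih (by omega), ih (by omega), ← hk, hk', hsum, hsum, hdrop, bargainValue]
    simp [permQ, hkN]

lemma U0perm_eq_bargainValue (T N : ℕ) (f : ℕ → ℝ → ℝ) (X : ℕ → ℕ → ℝ) (Q : ℕ → ℝ)
    (σ : Equiv.Perm (Fin N)) :
    U0perm T N f X Q σ =
      bargainValue (fun y : Fin T → ℝ => ∑ t : Fin T, f t (y t))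
        (fun (n : Fin N) (t : Fin T) => X n t)
        (fun n => Q n) (List.ofFn σ) 0 := by
  rw [U0perm, W, Waux_eq_bargainValue _ _ _ _ _ _ _ (Nat.sub_le _ _)]
  simp [Pi.zero_def]

lemma drop_ofFn_mul_swap {N m : ℕ} (σ : Equiv.Perm (Fin N)) {i j : Fin N} (hi : (i : ℕ) < m)
    (hj : (j : ℕ) < m) :
    (List.ofFn (σ * Equiv.swap i j)).drop m = (List.ofFn σ).drop m := by
  refine List.ext_getElem (by simp) fun n h₁ h₂ => ?_
  simp only [List.getElem_drop, List.getElem_ofFn, Equiv.Perm.mul_apply]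
  rw [Equiv.swap_apply_of_ne_of_ne] <;> simp only [ne_eq, Fin.ext_iff] <;> omega

lemma take_ofFn_mul_swap {N m : ℕ} (σ : Equiv.Perm (Fin N)) {i j : Fin N} (hi : m ≤ (i : ℕ))
    (hj : m ≤ (j : ℕ)) :
    (List.ofFn (σ * Equiv.swap i j)).take m = (List.ofFn σ).take m := by
  refine List.ext_getElem (by simp) fun n h₁ h₂ => ?_
  have hn : n < m := by simp at h₁; omega
  simp only [List.getElem_take, List.getElem_ofFn, Equiv.Perm.mul_apply]
  rw [Equiv.swap_apply_of_ne_of_ne] <;> simp only [ne_eq, Fin.ext_iff] <;> omega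

lemma exists_of_mem_take_ofFn {α : Type*} {N m : ℕ} {g : Fin N → α} {a : α}
    (h : a ∈ (List.ofFn g).take m) : ∃ i : Fin N, (i : ℕ) < m ∧ g i = a := by
  obtain ⟨n, hn, rfl⟩ := List.mem_iff_getElem.1 h
  simp only [List.length_take, List.length_ofFn] at hn
  exact ⟨⟨n, by omega⟩, by simp only; omega, by simp⟩

lemma exists_of_mem_drop_ofFn {α : Type*} {N m : ℕ} {g : Fin N → α} {a : α}
    (h : a ∈ (List.ofFn g).drop m) : ∃ i : Fin N, m ≤ (i : ℕ) ∧ g i = a := by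
  obtain ⟨n, hn, rfl⟩ := List.mem_iff_getElem.1 h
  simp only [List.length_drop, List.length_ofFn] at hn
  exact ⟨⟨m + n, by omega⟩, by simp, by simp⟩

/-- Theorem 1, interchange part: if the first `N₁` positions of `σ`
hold exactly the type-1 VOs and the last `N₃` positions hold exactly the type-3
VOs, then interchanging the positions of two type-1 VOs, or of two type-3 VOs,
leaves the MNO's payoff unchanged. -/
theorem interchange_same_type_payoff_eq (T N : ℕ) (hT : 1 ≤ T) (hN : 1 ≤ N)
    (f : ℕ → ℝ → ℝ) (X : ℕ → ℕ → ℝ) (Q : ℕ → ℝ)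
    (hf : ∀ t, t < T → MonotoneOn (f t) (Set.Ici (0 : ℝ)) ∧
      ConcaveOn ℝ (Set.Ici (0 : ℝ)) (f t) ∧ f t 0 = 0)
    (hX : ∀ n, n < N → ∀ t, t < T → 0 ≤ X n t)
    (σ : Equiv.Perm (Fin N))
    (hσ1 : ∀ i : Fin N, (i : ℕ) < numType1 N Q ↔ 0 ≤ Q ((σ i : Fin N) : ℕ))
    (hσ3 : ∀ i : Fin N, numType1 N Q + numType2 T N f X Q ≤ (i : ℕ) ↔
      (∑ t ∈ range T, f t (X ((σ i : Fin N) : ℕ) t)) + Q ((σ i : Fin N) : ℕ) < 0)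
    (i j : Fin N)
    (hij : (0 ≤ Q ((σ i : Fin N) : ℕ) ∧ 0 ≤ Q ((σ j : Fin N) : ℕ)) ∨
      ((∑ t ∈ range T, f t (X ((σ i : Fin N) : ℕ) t)) + Q ((σ i : Fin N) : ℕ) < 0 ∧
        (∑ t ∈ range T, f t (X ((σ j : Fin N) : ℕ) t)) + Q ((σ j : Fin N) : ℕ) < 0)) :
    U0perm T N f X Q (σ * Equiv.swap i j) = U0perm T N f X Q σ := by
  have hx : ∀ n : Fin N, (0 : Fin T → ℝ) ≤ fun t : Fin T => X n t := fun n t => hX n n.2 t t.2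
  have hperm : (List.ofFn (σ * Equiv.swap i j)).Perm (List.ofFn σ) :=
    Equiv.Perm.ofFn_comp_perm (Equiv.swap i j) σ
  rw [U0perm_eq_bargainValue, U0perm_eq_bargainValue]
  rcases hij with ⟨hi, hj⟩ | ⟨hi, hj⟩
  · set m := numType1 N Q
    have hdrop := drop_ofFn_mul_swap σ ((hσ1 i).2 hi) ((hσ1 j).2 hj)
    rw [← List.take_append_drop m (List.ofFn (σ * Equiv.swap i j)),
      ← List.take_append_drop m (List.ofFn σ),
      hdrop, List.perm_append_right_iff] at hperm
    rw [← List.take_append_drop m (List.ofFn (σ * Equiv.swap i j)),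
      ← List.take_append_drop m (List.ofFn σ),
      hdrop]
    refine (bargainValue_append_congr_left ?_ hx hperm.symm _ ?_ le_rfl).symm
    · intro y hy z hz hyz
      exact Finset.sum_le_sum fun t _ => (hf t t.2).1 (hy t) (hz t) (hyz t)
    · intro a ha
      obtain ⟨k, hk, rfl⟩ := exists_of_mem_take_ofFn ha
      exact (hσ1 k).1 hk
  · set m := numType1 N Q + numType2 T N f X Q
    have htake := take_ofFn_mul_swap σ ((hσ3 i).2 hi) ((hσ3 j).2 hj)
    rw [← List.take_append_drop m (List.ofFn (σ * Equiv.swap i j)),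
      ← List.take_append_drop m (List.ofFn σ),
      htake, List.perm_append_left_iff] at hperm
    have hrefused : ∀ a ∈ (List.ofFn σ).drop m, ∀ y : Fin T → ℝ, 0 ≤ y →
        ∑ t : Fin T, f t ((y + fun t : Fin T => X a t) t) + Q a ≤ ∑ t : Fin T, f t (y t) := by
      intro a ha y hy
      obtain ⟨k, hk, rfl⟩ := exists_of_mem_drop_ofFn ha
      have h₁ := (hσ3 k).1 hk
      rw [Finset.sum_range] at h₁
      have h₂ : ∑ t : Fin T, f t ((y + fun t : Fin T => X (σ k) t) t) ≤
          ∑ t : Fin T, (f t (y t) + f t (X (σ k) t)) :=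
        Finset.sum_le_sum fun t _ =>
          (hf t t.2).2.1.map_add_le_of_map_zero (hf t t.2).2.2 (hy t) (hx (σ k) t)
      rw [Finset.sum_add_distrib] at h₂
      linarith
    rw [← List.take_append_drop m (List.ofFn (σ * Equiv.swap i j)),
      ← List.take_append_drop m (List.ofFn σ),
      htake,
      bargainValue_append_of_refused _ (fun a ha => hrefused a (hperm.mem_iff.1 ha)) hx le_rfl,
      bargainValue_append_of_refused _ hrefused hx le_rfl]
end

section
/- Suppose the VOs are homogeneous: Q_n = Q and X_n^t = X^t for all n ∈ {1,…,N} and t ∈ {1,…,T}. Then the realized VO payoffs are nonincreasing in the bargaining position: π̂_1 ≥ π̂_2 ≥ … ≥ π̂_N. In particular, a VO bargaining at an earlier position obtains a payoff at least as large as a VO bargaining at a later position. -/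
open Finset

/-- Number of agreements among the first `k` outcomes. -/
def agreeCount (b : ℕ → Bool) (k : ℕ) : ℕ := #{n ∈ range k | b n = true}

/-- Total benefit from `m` homogeneous agreements. -/
noncomputable def countBenefit (T : ℕ) (f : ℕ → ℝ → ℝ) (x : ℕ → ℝ) (m : ℕ) : ℝ :=
  ∑ t ∈ range T, f t (m * x t)

/-- Value of holding `m` agreements with `j` homogeneous bargaining steps remaining, for terminal
benefit `g` and per-agreement gain `q`. -/
noncomputable def countValue (g : ℕ → ℝ) (q : ℝ) : ℕ → ℕ → ℝ
  | 0, m => g m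
  | j + 1, m => (1 / 2) * countValue g q j m
      + (1 / 2) * max (countValue g q j m) (countValue g q j (m + 1) + q)

/-- Surplus of an `(m + 1)`-st agreement with `j` bargaining steps remaining after it. -/
noncomputable def countSurplus (g : ℕ → ℝ) (q : ℝ) (j m : ℕ) : ℝ :=
  countValue g q j (m + 1) - countValue g q j m + q

theorem agreeCount_succ_update (b : ℕ → Bool) (k : ℕ) (v : Bool) :
    agreeCount (Function.update b k v) (k + 1) = agreeCount b k + if v then 1 else 0 := by
  have h : {n ∈ range k | Function.update b k v n = true} = {n ∈ range k | b n = true} := by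
    refine filter_congr fun n hn => ?_
    rw [Function.update_of_ne (mem_range.1 hn).ne]
  unfold agreeCount
  rw [range_add_one, filter_insert, h, Function.update_self]
  cases v <;> simp

theorem countValue_succ (g : ℕ → ℝ) (q : ℝ) (j m : ℕ) :
    countValue g q (j + 1) m = countValue g q j m + max 0 (countSurplus g q j m) / 2 := by
  have h : max (countValue g q j m) (countValue g q j (m + 1) + q)
      = countValue g q j m + max 0 (countSurplus g q j m) := by
    rw [← max_add_add_left, countSurplus]
    congr 1 <;> ring
  rw [countValue, h]
  ring

theorem countSurplus_succ (g : ℕ → ℝ) (q : ℝ) (j m : ℕ) :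
    countSurplus g q (j + 1) m = countSurplus g q j m
      + (max 0 (countSurplus g q j (m + 1)) - max 0 (countSurplus g q j m)) / 2 := by
  rw [countSurplus, countValue_succ, countValue_succ, countSurplus.eq_def g q j m]
  ring

theorem countSurplus_succ_le {g : ℕ → ℝ} (q : ℝ)
    (hg : ∀ m, g (m + 2) - g (m + 1) ≤ g (m + 1) - g m) (j m : ℕ) :
    countSurplus g q j (m + 1) ≤ countSurplus g q j m := by
  induction j generalizing m with
  | zero => simpa [countSurplus, countValue] using hg m
  | succ j ih =>
    have h₁ := ih m
    have h₂ := ih (m + 1)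
    rw [countSurplus_succ, countSurplus_succ]
    have h₃ := max_le_max_left 0 h₂
    rcases max_cases 0 (countSurplus g q j m) with h | h <;>
      rcases max_cases 0 (countSurplus g q j (m + 1)) with h' | h' <;> linarith

theorem countSurplus_neg_of_succ_neg {g : ℕ → ℝ} {q : ℝ} {j m : ℕ}
    (h : countSurplus g q (j + 1) m < 0) : countSurplus g q j m < 0 := by
  rw [countSurplus_succ] at h
  have h' := le_max_left 0 (countSurplus g q j (m + 1))
  rcases max_cases 0 (countSurplus g q j m) with h'' | h'' <;> linarith

theorem posPart_countSurplus_le {g : ℕ → ℝ} {q : ℝ}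
    (hg : ∀ m, g (m + 2) - g (m + 1) ≤ g (m + 1) - g m) {j m : ℕ}
    (h : 0 ≤ countSurplus g q (j + 1) m) :
    max 0 (countSurplus g q j (m + 1)) ≤ countSurplus g q (j + 1) m := by
  have hm := countSurplus_succ_le q hg j m
  rw [countSurplus_succ] at h ⊢
  rcases max_cases 0 (countSurplus g q j m) with h' | h' <;>
    rcases max_cases 0 (countSurplus g q j (m + 1)) with h'' | h'' <;> linarith

theorem countBenefit_concave {T : ℕ} {f : ℕ → ℝ → ℝ} {x : ℕ → ℝ}
    (hf : ∀ t, t < T → ConcaveOn ℝ (Set.Ici (0 : ℝ)) (f t)) (hx : ∀ t, t < T → 0 ≤ x t) (m : ℕ) :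
    countBenefit T f x (m + 2) - countBenefit T f x (m + 1)
      ≤ countBenefit T f x (m + 1) - countBenefit T f x m := by
  simp only [countBenefit, ← sum_sub_distrib]
  refine sum_le_sum fun t ht => ?_
  rw [mem_range] at ht
  have hxt := hx t ht
  have h := (hf t ht).2 (x := m * x t) (y := (m + 2 : ℕ) * x t)
    (Set.mem_Ici.2 (by positivity)) (Set.mem_Ici.2 (by positivity))
    (by norm_num : (0 : ℝ) ≤ 1 / 2) (by norm_num : (0 : ℝ) ≤ 1 / 2) (by norm_num)
  have hmid : (1 / 2 : ℝ) • (m * x t) + (1 / 2 : ℝ) • ((m + 2 : ℕ) * x t)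
      = (m + 1 : ℕ) * x t := by
    simp only [smul_eq_mul]
    push_cast
    ring
  rw [hmid, smul_eq_mul, smul_eq_mul] at h
  linarith

section Homogeneous

variable {T N : ℕ} {f : ℕ → ℝ → ℝ} {X : ℕ → ℕ → ℝ} {Q : ℕ → ℝ} {q : ℝ} {x : ℕ → ℝ}

theorem socialOffload_eq_countBenefit (hXh : ∀ n, n < N → ∀ t, t < T → X n t = x t)
    (b : ℕ → Bool) : socialOffload T N f X b = countBenefit T f x (agreeCount b N) := by
  refine sum_congr rfl fun t ht => ?_
  congr 1
  rw [← sum_filter, agreeCount, ← nsmul_eq_mul]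
  refine sum_eq_card_nsmul fun n hn => ?_
  exact hXh n (mem_range.1 (mem_filter.1 hn).1) t (mem_range.1 ht)

theorem Waux_eq_countValue (hQh : ∀ n, n < N → Q n = q)
    (hXh : ∀ n, n < N → ∀ t, t < T → X n t = x t) {j : ℕ} (hj : j ≤ N) (b : ℕ → Bool) :
    Waux T N f X Q j b = countValue (countBenefit T f x) q j (agreeCount b (N - j)) := by
  induction j generalizing b with
  | zero => exact socialOffload_eq_countBenefit hXh b
  | succ j ih =>
    have hk : N - j = N - (j + 1) + 1 := by omega
    rw [Waux, ih (by omega), ih (by omega), hQh _ (by omega), hk, agreeCount_succ_update,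
      agreeCount_succ_update, countValue]
    simp

theorem Delta_eq_countSurplus (hQh : ∀ n, n < N → Q n = q)
    (hXh : ∀ n, n < N → ∀ t, t < T → X n t = x t) {k : ℕ} (hk : k < N) (b : ℕ → Bool) :
    Delta T N f X Q k b
      = countSurplus (countBenefit T f x) q (N - (k + 1)) (agreeCount b k) := by
  have h : N - (N - (k + 1)) = k + 1 := by omega
  rw [Delta, W, W, Waux_eq_countValue hQh hXh (by omega), Waux_eq_countValue hQh hXh (by omega),
    hQh k hk, h, agreeCount_succ_update, agreeCount_succ_update, countSurplus]
  simp

theorem pihat_succ_le (hf : ∀ t, t < T → ConcaveOn ℝ (Set.Ici (0 : ℝ)) (f t))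
    (hx : ∀ t, t < T → 0 ≤ x t) (hQh : ∀ n, n < N → Q n = q)
    (hXh : ∀ n, n < N → ∀ t, t < T → X n t = x t) {k : ℕ} (hk : k + 1 < N) :
    pihat T N f X Q (k + 1) ≤ pihat T N f X Q k := by
  have hj : N - (k + 1) = N - (k + 1 + 1) + 1 := by omega
  rw [pihat, pihat, Delta_eq_countSurplus hQh hXh hk, bhatFn, agreeCount_succ_update,
    Delta_eq_countSurplus hQh hXh (by omega : k < N), hj]
  generalize agreeCount (bhatFn T N f X Q k) k = m
  generalize N - (k + 1 + 1) = j
  by_cases h : 0 ≤ countSurplus (countBenefit T f x) q (j + 1) m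
  · have hle := max_le_iff.1 (posPart_countSurplus_le (countBenefit_concave hf hx) h)
    simp only [h, if_true]
    split_ifs <;> linarith
  · have hneg := countSurplus_neg_of_succ_neg (not_le.1 h)
    simp [h, hneg.not_ge]

end Homogeneous

/-- Theorem 5: with homogeneous VOs (`Q_n = Q`, `X_n^t = X^t` for
all `n`, `t`), the realized VO payoffs are nonincreasing in the bargaining
position: `π̂_1 ≥ π̂_2 ≥ … ≥ π̂_N`. -/
theorem homogeneous_payoffs_antitone (T N : ℕ) (hT : 1 ≤ T) (hN : 1 ≤ N)
    (f : ℕ → ℝ → ℝ) (X : ℕ → ℕ → ℝ) (Q : ℕ → ℝ) (Qc : ℝ) (Xc : ℕ → ℝ)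
    (hf : ∀ t, t < T → MonotoneOn (f t) (Set.Ici (0 : ℝ)) ∧
      ConcaveOn ℝ (Set.Ici (0 : ℝ)) (f t) ∧ f t 0 = 0)
    (hX : ∀ n, n < N → ∀ t, t < T → 0 ≤ X n t)
    (hQh : ∀ n, n < N → Q n = Qc)
    (hXh : ∀ n, n < N → ∀ t, t < T → X n t = Xc t) :
    ∀ i j, i ≤ j → j < N → pihat T N f X Q j ≤ pihat T N f X Q i := by
  have hx : ∀ t, t < T → 0 ≤ Xc t := fun t ht => hXh 0 hN t ht ▸ hX 0 hN t ht
  intro i j hij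
  induction j, hij using Nat.le_induction with
  | base => exact fun _ => le_rfl
  | succ k _ ih =>
    intro hk
    exact (pihat_succ_le (fun t ht => (hf t ht).2.1) hx hQh hXh hk).trans (ih (by omega))
end
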